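/- arXiv:1508.02694 — 3 statements merged into one kernel-verified Lean document; each statement's English description precedes it below -/
import Mathlib

section
/- A positive integer m is represented by the quadratic form x^2 + y^2 + 2z^2 (i.e., there exist integers x, y, z with x^2 + y^2 + 2z^2 = m) if and only if m is not of the form 4^k(16ℓ + 14) for some nonnegative integers k and ℓ. -/
open scoped NumberTheorySymbols

/-- Every positive definite binary form `A x² + 2 B x y + C y²` is properly equivalent to one whose
leading coefficient `A'` satisfies `3 A'² ≤ 4 (A C - B²)`. -/
theorem exists_unimodular_leading_coeff_le (A B C : ℤ) (hA : 0 < A) (hD : 0 < A * C - B ^ 2) :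
    ∃ p q r s : ℤ, p * s - q * r = 1 ∧ 0 < A * p ^ 2 + 2 * B * p * r + C * r ^ 2 ∧
      3 * (A * p ^ 2 + 2 * B * p * r + C * r ^ 2) ^ 2 ≤ 4 * (A * C - B ^ 2) := by
  induction h : A.toNat using Nat.strong_induction_on generalizing A B C with
  | _ N ih =>
    subst h
    obtain ⟨k, hk⟩ : ∃ k : ℤ, (2 * (B + k * A)) ^ 2 ≤ A ^ 2 := by
      refine ⟨-((2 * B + A) / (2 * A)), sq_le_sq' ?_ ?_⟩ <;>
      · have h1 := Int.emod_add_mul_ediv (2 * B + A) (2 * A)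
        have h2 := Int.emod_nonneg (2 * B + A) (b := 2 * A) (by omega)
        have h3 := Int.emod_lt_of_pos (2 * B + A) (b := 2 * A) (by omega)
        linarith
    obtain ⟨B', hB'⟩ : ∃ B', B' = B + k * A := ⟨_, rfl⟩
    obtain ⟨C', hC'⟩ : ∃ C', C' = A * k ^ 2 + 2 * B * k + C := ⟨_, rfl⟩
    have hdisc : A * C' - B' ^ 2 = A * C - B ^ 2 := by rw [hB', hC']; ring
    rw [← hB'] at hk
    rcases le_or_gt A C' with hle | hlt
    · refine ⟨1, 0, 0, 1, by norm_num, by simpa using hA, ?_⟩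
      have : A * A ≤ A * C' := mul_le_mul_of_nonneg_left hle hA.le
      nlinarith
    · have hC'0 : 0 < C' := by
        have : 0 < A * C' := by linarith [sq_nonneg B']
        exact pos_of_mul_pos_right this hA.le
      obtain ⟨p, q, r, s, h1, h2, h3⟩ := ih C'.toNat (by omega) C' (-B') A hC'0
        (by linarith [neg_sq B', mul_comm A C']) rfl
      refine ⟨k * p - r, k * q - s, p, q, by linear_combination h1, ?_, ?_⟩
      · convert h2 using 1
        rw [hB', hC']; ring
      · convert h3 using 1
        · rw [hB', hC']; ring
        · linear_combination -4 * hdisc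

/-- A positive definite integral ternary form with determinant `2` is represented by
`u² + v² + 2 w²`. -/
theorem ternary_det_two_eq (a b c d e f : ℤ) (ha : 0 < a) (hab : 0 < a * b - f ^ 2)
    (hdet : a * b * c + 2 * d * e * f - a * d ^ 2 - b * e ^ 2 - c * f ^ 2 = 2) (x y z : ℤ) :
    ∃ u v w : ℤ, u ^ 2 + v ^ 2 + 2 * w ^ 2 =
      a * x ^ 2 + b * y ^ 2 + c * z ^ 2 + 2 * d * y * z + 2 * e * x * z + 2 * f * x * y := by
  induction h : a.toNat using Nat.strong_induction_on generalizing a b c d e f x y z with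
  | _ N ih =>
    subst h
    have hG : (a * b - f ^ 2) * (a * c - e ^ 2) - (a * d - e * f) ^ 2 = 2 * a := by
      linear_combination a * hdet
    obtain ⟨p, q, r, s, h1, h2, h3⟩ :=
      exists_unimodular_leading_coeff_le (a * b - f ^ 2) (a * d - e * f) (a * c - e ^ 2) hab
        (by rw [hG]; omega)
    rw [hG] at h3
    obtain ⟨G, hGdef⟩ : ∃ G, G = (a * b - f ^ 2) * p ^ 2 + 2 * (a * d - e * f) * p * r +
      (a * c - e ^ 2) * r ^ 2 := ⟨_, rfl⟩
    rw [← hGdef] at h2 h3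
    obtain ⟨k, hk⟩ : ∃ k : ℤ, (2 * (f * p + e * r + k * a)) ^ 2 ≤ a ^ 2 := by
      refine ⟨-((2 * (f * p + e * r) + a) / (2 * a)), sq_le_sq' ?_ ?_⟩ <;>
      · have h1 := Int.emod_add_mul_ediv (2 * (f * p + e * r) + a) (2 * a)
        have h2 := Int.emod_nonneg (2 * (f * p + e * r) + a) (b := 2 * a) (by omega)
        have h3 := Int.emod_lt_of_pos (2 * (f * p + e * r) + a) (b := 2 * a) (by omega)
        linarith
    -- coefficients after `(x, y, z) ↦ (x + k y, p y + q z, r y + s z)`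
    obtain ⟨f', hf'⟩ : ∃ f', f' = f * p + e * r + k * a := ⟨_, rfl⟩
    obtain ⟨e', he'⟩ : ∃ e', e' = f * q + e * s := ⟨_, rfl⟩
    obtain ⟨b', hb'⟩ : ∃ b', b' = a * k ^ 2 + b * p ^ 2 + c * r ^ 2 + 2 * d * p * r
      + 2 * e * k * r + 2 * f * k * p := ⟨_, rfl⟩
    obtain ⟨c', hc'⟩ : ∃ c', c' = b * q ^ 2 + c * s ^ 2 + 2 * d * q * s := ⟨_, rfl⟩
    obtain ⟨d', hd'⟩ : ∃ d', d' = b * p * q + c * r * s + d * (p * s + q * r)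
      + e * k * s + f * k * q := ⟨_, rfl⟩
    have hGf : a * b' - f' ^ 2 = G := by rw [hf', hb', hGdef]; ring
    have hdet' : a * b' * c' + 2 * d' * e' * f' - a * d' ^ 2 - b' * e' ^ 2 - c' * f' ^ 2 = 2 := by
      have : a * b' * c' + 2 * d' * e' * f' - a * d' ^ 2 - b' * e' ^ 2 - c' * f' ^ 2 =
          (a * b * c + 2 * d * e * f - a * d ^ 2 - b * e ^ 2 - c * f ^ 2) *
            (p * s - q * r) ^ 2 := by
        rw [hf', he', hb', hc', hd']; ring
      rw [this, hdet, h1]; norm_num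
    rw [← hf'] at hk
    -- the coordinates of `(x, y, z)` in the new basis
    obtain ⟨y', hy'⟩ : ∃ y', y' = s * y - q * z := ⟨_, rfl⟩
    obtain ⟨z', hz'⟩ : ∃ z', z' = p * z - r * y := ⟨_, rfl⟩
    have hy : y = p * y' + q * z' := by rw [hy', hz']; linear_combination -y * h1
    have hz : z = r * y' + s * z' := by rw [hy', hz']; linear_combination -z * h1
    have hval : a * x ^ 2 + b * y ^ 2 + c * z ^ 2 + 2 * d * y * z + 2 * e * x * z + 2 * f * x * y =
        a * (x - k * y') ^ 2 + b' * y' ^ 2 + c' * z' ^ 2 + 2 * d' * y' * z'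
          + 2 * e' * (x - k * y') * z' + 2 * f' * (x - k * y') * y' := by
      rw [hf', he', hb', hc', hd', hy, hz]; ring
    rw [hval]
    rcases lt_or_ge b' a with hlt | hge
    · have hb'0 : 0 < b' := by
        have : 0 < a * b' := by linarith [sq_nonneg f']
        exact pos_of_mul_pos_right this ha.le
      obtain ⟨u, v, w, huvw⟩ := ih b'.toNat (by omega) b' a c' e' d' f' hb'0
        (by rw [mul_comm, hGf]; exact h2) (by linear_combination hdet') y' (x - k * y') z' rfl
      exact ⟨u, v, w, by rw [huvw]; ring⟩
    · have ha2 : 3 * a ^ 2 ≤ 4 * G := by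
        have : a * a ≤ a * b' := mul_le_mul_of_nonneg_left hge ha.le
        linarith
      have ha1 : a = 1 := by
        by_contra hne
        have h2a : 2 ≤ a := by omega
        have h8 : a * 2 ^ 3 ≤ a * a ^ 3 := by gcongr
        have h9 : (3 * a ^ 2) ^ 2 ≤ (4 * G) ^ 2 := by gcongr
        linarith
      subst ha1
      have hG1 : G = 1 := by
        have : G < 2 := by
          by_contra! hG2
          have : 2 ^ 2 ≤ G ^ 2 := by gcongr
          linarith
        omega
      have hGc : c' - e' ^ 2 = 2 + (d' - e' * f') ^ 2 := by
        rw [hG1] at hGf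
        linear_combination hdet' - (c' - e' ^ 2) * hGf
      refine ⟨x - k * y' + f' * y' + e' * z', y' + (d' - e' * f') * z', z', ?_⟩
      rw [hG1] at hGf
      linear_combination -z' ^ 2 * hGc - y' ^ 2 * hGf

theorem exists_rep_of_dvd (m D N e h : ℤ) (hD : 0 < D) (hN : 0 < N) (hdet : m * D - e ^ 2 * N = 2)
    (hdvd : N ∣ h ^ 2 + D) : ∃ x y z : ℤ, x ^ 2 + y ^ 2 + 2 * z ^ 2 = m := by
  obtain ⟨a, ha⟩ := hdvd
  have ha0 : 0 < a := by
    have : 0 < N * a := by rw [← ha]; positivity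
    exact pos_of_mul_pos_right this hN.le
  obtain ⟨u, v, w, huvw⟩ := ternary_det_two_eq a N m 0 e h ha0 (by linarith)
    (by linear_combination hdet - m * ha) 0 0 1
  exact ⟨u, v, w, by rw [huvw]; ring⟩

theorem exists_prime_eq_add_mul (r q : ℕ) (hq : q ≠ 0) (h : IsCoprime (r : ℤ) q) :
    ∃ p t : ℕ, p.Prime ∧ p = r + q * t := by
  obtain ⟨p, hgt, hp, hmod⟩ := Nat.forall_exists_prime_gt_and_modEq r hq
    (Nat.isCoprime_iff_coprime.1 h)
  obtain ⟨t, ht⟩ := (Nat.modEq_iff_dvd' hgt.le).1 hmod.symm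
  exact ⟨p, t, hp, by omega⟩

theorem exists_dvd_sq_add_of_jacobiSym {p D : ℕ} (hp : p.Prime) (h : J(-D | p) = 1) :
    ∃ x : ℤ, (p : ℤ) ∣ x ^ 2 + D := by
  have : Fact p.Prime := ⟨hp⟩
  obtain ⟨y, hy⟩ := ZMod.isSquare_of_jacobiSym_eq_one h
  obtain ⟨x, rfl⟩ := ZMod.intCast_surjective y
  refine ⟨x, (ZMod.intCast_zmod_eq_zero_iff_dvd _ p).1 ?_⟩
  push_cast at hy ⊢
  linear_combination -hy

theorem jacobiSym_eq_of_dvd_sub {a b : ℤ} {n : ℕ} (h : (n : ℤ) ∣ a - b) : J(a | n) = J(b | n) :=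
  jacobiSym.mod_left' (Int.modEq_iff_dvd.2 h).symm

theorem jacobiSym_neg_of_three_mod_eight {p D : ℕ} (hp : Odd p) (hD : D % 8 = 3)
    (h : D ∣ p + 2) : J(-D | p) = 1 := by
  have hDodd : Odd D := Nat.odd_iff.2 (by omega)
  have h1 : J(p | D) = 1 := by
    rw [jacobiSym_eq_of_dvd_sub (b := -2) (by simpa using Int.natCast_dvd_natCast.2 h),
      jacobiSym.at_neg_two hDodd, ZMod.χ₈'_nat_eq_if_mod_eight]
    simp [hD, show D % 2 ≠ 0 by omega]
  rw [jacobiSym.neg _ hp]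
  rcases Nat.odd_mod_four_iff.1 (Nat.odd_iff.1 hp) with h4 | h4
  · rw [ZMod.χ₄_nat_one_mod_four h4, jacobiSym.quadratic_reciprocity_one_mod_four' hDodd h4, h1]
    norm_num
  · rw [ZMod.χ₄_nat_three_mod_four h4,
      jacobiSym.quadratic_reciprocity_three_mod_four (by omega) h4, h1]
    norm_num

theorem jacobiSym_neg_two_mul {p n E : ℕ} (hn : n % 4 = 1) (hE : Odd E)
    (h : p + 1 = 2 * (n * E)) : J(-(2 * E : ℕ) | p) = 1 := by
  have hE2 := Nat.odd_iff.1 hE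
  have hnE : (n * E) % 4 = E % 4 := by rw [Nat.mul_mod, hn]; omega
  have hp : Odd p := Nat.odd_iff.2 (by omega)
  have h1 : J(p | E) = ZMod.χ₄ E := by
    rw [jacobiSym_eq_of_dvd_sub (b := -1), jacobiSym.at_neg_one hE]
    exact ⟨2 * n, by push_cast [sub_neg_eq_add]; exact_mod_cast h.trans (by ring)⟩
  rw [show (-(2 * E : ℕ) : ℤ) = -2 * (E : ℤ) by push_cast; ring, jacobiSym.mul_left,
    jacobiSym.at_neg_two hp, jacobiSym.quadratic_reciprocity_one_mod_four' hE (by omega), h1,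
    ZMod.χ₈'_nat_eq_if_mod_eight, ZMod.χ₄_nat_eq_if_mod_four]
  split_ifs <;> omega

theorem jacobiSym_neg_of_one_mod_eight {p n D : ℕ} (hn : n % 8 = 3) (hD : D % 8 = 1)
    (h : 2 * p + 1 = n * D) : J(-D | p) = 1 := by
  have hnD : (n * D) % 8 = 3 := by rw [Nat.mul_mod, hn, hD]
  have hDodd : Odd D := Nat.odd_iff.2 (by omega)
  have hp : Odd p := Nat.odd_iff.2 (by omega)
  have h1 : J(p | D) = 1 := by
    have h2 : J(2 * p | D) = 1 := by
      rw [jacobiSym_eq_of_dvd_sub (b := -1), jacobiSym.at_neg_one hDodd,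
        ZMod.χ₄_nat_one_mod_four (by omega)]
      exact ⟨n, by push_cast [sub_neg_eq_add]; exact_mod_cast h.trans (by ring)⟩
    rw [jacobiSym.mul_left, jacobiSym.at_two hDodd, ZMod.χ₈_nat_eq_if_mod_eight] at h2
    simpa [hD, show D % 2 ≠ 0 by omega] using h2
  rw [jacobiSym.neg _ hp, ZMod.χ₄_nat_one_mod_four (by omega),
    jacobiSym.quadratic_reciprocity_one_mod_four' hDodd (by omega), h1]
  norm_num

theorem exists_rep_of_odd {m : ℕ} (hm : Odd m) :
    ∃ x y z : ℤ, x ^ 2 + y ^ 2 + 2 * z ^ 2 = m := by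
  obtain ⟨j, rfl⟩ := hm
  obtain ⟨p, t, hp, hpt⟩ := exists_prime_eq_add_mul (6 * j + 1) (8 * (2 * j + 1)) (by positivity)
    (by
      push_cast
      rw [show (8 : ℤ) = 2 ^ 3 by norm_num]
      refine IsCoprime.mul_right (IsCoprime.pow_right ?_) ?_
      · exact ⟨1, -3 * j, by ring⟩
      · exact ⟨j, 1 - 3 * j, by ring⟩)
  have hpD : p + 2 = (2 * j + 1) * (8 * t + 3) := by rw [hpt]; ring
  obtain ⟨h, hh⟩ := exists_dvd_sq_add_of_jacobiSym hp (jacobiSym_neg_of_three_mod_eight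
    (D := 8 * t + 3) ⟨3 * j + 4 * (2 * j + 1) * t, by rw [hpt]; ring⟩ (by omega)
    ⟨_, hpD.trans (mul_comm _ _)⟩)
  refine exists_rep_of_dvd _ ((8 * t + 3 : ℕ) : ℤ) p 1 h (by positivity)
    (by exact_mod_cast hp.pos) ?_ hh
  zify at hpD
  push_cast at hpD ⊢
  linear_combination -hpD

theorem exists_rep_two_mul_of_one_mod_four {n : ℕ} (hn : n % 4 = 1) :
    ∃ x y z : ℤ, x ^ 2 + y ^ 2 + 2 * z ^ 2 = (2 * n : ℕ) := by
  obtain ⟨i, rfl⟩ : ∃ i, n = 4 * i + 1 := ⟨n / 4, by omega⟩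
  obtain ⟨p, t, hp, hpt⟩ := exists_prime_eq_add_mul (8 * i + 1) (4 * (4 * i + 1)) (by positivity)
    (by push_cast; exact IsCoprime.mul_right ⟨1, -2 * (i : ℤ), by ring⟩ ⟨-1, 2, by ring⟩)
  have hpE : p + 1 = 2 * ((4 * i + 1) * (2 * t + 1)) := by rw [hpt]; ring
  obtain ⟨h, hh⟩ := exists_dvd_sq_add_of_jacobiSym hp
    (jacobiSym_neg_two_mul (n := 4 * i + 1) (E := 2 * t + 1) (by omega) (by simp) hpE)
  have hpodd : Odd (p : ℤ) := by exact_mod_cast Nat.odd_iff.2 (by omega)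
  obtain ⟨g, hg, hge⟩ : ∃ g : ℤ, (p : ℤ) ∣ g ^ 2 + (2 * (2 * t + 1) : ℕ) ∧ Even g := by
    rcases Int.even_or_odd h with he | ho
    · exact ⟨h, hh, he⟩
    · refine ⟨h + p, ?_, ho.add_odd hpodd⟩
      rw [show (h + p) ^ 2 + ((2 * (2 * t + 1) : ℕ) : ℤ) =
        h ^ 2 + ((2 * (2 * t + 1) : ℕ) : ℤ) + p * (2 * h + p) by ring]
      exact hh.add (dvd_mul_right _ _)
  have h2 : (2 : ℤ) ∣ g ^ 2 + (2 * (2 * t + 1) : ℕ) := by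
    push_cast
    exact (hge.two_dvd.pow two_ne_zero).add (dvd_mul_right _ _)
  have hcop : IsCoprime (2 : ℤ) p := Int.isCoprime_two_left.2 hpodd
  refine exists_rep_of_dvd _ ((2 * (2 * t + 1) : ℕ) : ℤ) (2 * p) 1 g (by positivity)
    (by have := hp.pos; positivity) ?_ (hcop.mul_dvd h2 hg)
  zify at hpE
  push_cast at hpE ⊢
  linear_combination -2 * hpE

theorem exists_rep_two_mul_of_three_mod_eight {n : ℕ} (hn : n % 8 = 3) :
    ∃ x y z : ℤ, x ^ 2 + y ^ 2 + 2 * z ^ 2 = (2 * n : ℕ) := by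
  obtain ⟨i, rfl⟩ : ∃ i, n = 8 * i + 3 := ⟨n / 8, by omega⟩
  obtain ⟨p, t, hp, hpt⟩ := exists_prime_eq_add_mul (4 * i + 1) (4 * (8 * i + 3)) (by positivity)
    (by push_cast; exact IsCoprime.mul_right ⟨1, -(i : ℤ), by ring⟩ ⟨-2, 1, by ring⟩)
  have hpD : 2 * p + 1 = (8 * i + 3) * (8 * t + 1) := by rw [hpt]; ring
  obtain ⟨h, hh⟩ := exists_dvd_sq_add_of_jacobiSym hp
    (jacobiSym_neg_of_one_mod_eight (n := 8 * i + 3) (D := 8 * t + 1) (by omega) (by omega) hpD)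
  refine exists_rep_of_dvd _ ((8 * t + 1 : ℕ) : ℤ) p 2 h (by positivity)
    (by exact_mod_cast hp.pos) ?_ hh
  zify at hpD
  push_cast at hpD ⊢
  linear_combination -2 * hpD

theorem exists_rep_of_ne_four_pow_mul (m : ℕ) (hm : 0 < m)
    (h : ∀ k l : ℕ, m ≠ 4 ^ k * (16 * l + 14)) :
    ∃ x y z : ℤ, x ^ 2 + y ^ 2 + 2 * z ^ 2 = m := by
  induction m using Nat.strong_induction_on with
  | _ m ih =>
    by_cases h4 : 4 ∣ m
    · obtain ⟨n, rfl⟩ := h4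
      obtain ⟨x, y, z, hxyz⟩ := ih n (by omega) (by omega)
        fun k l hkl => h (k + 1) l (by rw [hkl]; ring)
      exact ⟨2 * x, 2 * y, 2 * z, by push_cast; linear_combination 4 * hxyz⟩
    · have h14 : m % 16 ≠ 14 := fun h14 => h 0 (m / 16) (by omega)
      rcases Nat.even_or_odd' m with ⟨n, rfl | rfl⟩
      · by_cases hn : n % 4 = 1
        · exact exists_rep_two_mul_of_one_mod_four hn
        · exact exists_rep_two_mul_of_three_mod_eight (by omega)
      · exact exists_rep_of_odd (by simp)

theorem sq_emod_sixteen (x : ℤ) :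
    x % 2 = 0 ∧ (x ^ 2 % 16 = 0 ∨ x ^ 2 % 16 = 4) ∨
      x % 2 = 1 ∧ (x ^ 2 % 16 = 1 ∨ x ^ 2 % 16 = 9) := by
  have h : x % 16 = 0 ∨ x % 16 = 1 ∨ x % 16 = 2 ∨ x % 16 = 3 ∨ x % 16 = 4 ∨ x % 16 = 5 ∨
      x % 16 = 6 ∨ x % 16 = 7 ∨ x % 16 = 8 ∨ x % 16 = 9 ∨ x % 16 = 10 ∨ x % 16 = 11 ∨
      x % 16 = 12 ∨ x % 16 = 13 ∨ x % 16 = 14 ∨ x % 16 = 15 := by omega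
  rw [pow_two, Int.mul_emod]
  rcases h with h | h | h | h | h | h | h | h | h | h | h | h | h | h | h | h <;>
    rw [h] <;> omega

theorem ne_four_pow_mul (k l : ℕ) (x y z : ℤ) :
    x ^ 2 + y ^ 2 + 2 * z ^ 2 ≠ 4 ^ k * (16 * l + 14) := by
  induction k generalizing x y z with
  | zero =>
    intro h
    have := sq_emod_sixteen x
    have := sq_emod_sixteen y
    have := sq_emod_sixteen z
    omega
  | succ k ih =>
    intro h
    have hx := sq_emod_sixteen x
    have hy := sq_emod_sixteen y
    have hz := sq_emod_sixteen z
    have h8 : x ^ 2 + y ^ 2 + 2 * z ^ 2 = 8 * (4 ^ k * (8 * l + 7)) := by rw [h]; ring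
    obtain ⟨x', rfl⟩ : (2 : ℤ) ∣ x := by omega
    obtain ⟨y', rfl⟩ : (2 : ℤ) ∣ y := by omega
    obtain ⟨z', rfl⟩ : (2 : ℤ) ∣ z := by omega
    refine ih x' y' z' (mul_left_cancel₀ (four_ne_zero (α := ℤ)) ?_)
    linear_combination h

theorem rep_x2_y2_2z2 (m : ℤ) (hm : 0 < m) :
    (∃ x y z : ℤ, x ^ 2 + y ^ 2 + 2 * z ^ 2 = m) ↔
      ¬ ∃ k l : ℕ, m = 4 ^ k * (16 * l + 14) := by
  constructor
  · rintro ⟨x, y, z, hxyz⟩ ⟨k, l, hkl⟩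
    exact ne_four_pow_mul k l x y z (hxyz.trans hkl)
  · intro h
    lift m to ℕ using hm.le
    exact exists_rep_of_ne_four_pow_mul m (by exact_mod_cast hm)
      fun k l hkl => h ⟨k, l, by exact_mod_cast hkl⟩
end

section
/- A positive integer m is represented by the quadratic form x^2 + 2y^2 + 4z^2 (i.e., there exist integers x, y, z with x^2 + 2y^2 + 4z^2 = m) if and only if m is not of the form 4^k(16ℓ + 14) for some nonnegative integers k and ℓ. -/
/-- Lagrange–Gauss reduction of a positive definite binary form `A x² + 2 B x y + C y²`. -/
theorem exists_reduced_binary_form (A B C D : ℤ) (hA : 0 < A) (hD : 0 < D)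
    (h : A * C - B ^ 2 = D) :
    ∃ p q r s : ℤ, p * s - q * r = 1 ∧ 0 < A * p ^ 2 + 2 * B * p * r + C * r ^ 2 ∧
      3 * (A * p ^ 2 + 2 * B * p * r + C * r ^ 2) ^ 2 ≤ 4 * D := by
  induction hn : A.toNat using Nat.strong_induction_on generalizing A B C with
  | _ n ih =>
    by_cases hred : 3 * A ^ 2 ≤ 4 * D
    · exact ⟨1, 0, 0, 1, by ring, by linarith, by ring_nf at hred ⊢; exact hred⟩
    obtain ⟨t, ht₁, ht₂⟩ : ∃ t : ℤ, -A ≤ 2 * (B + A * t) ∧ 2 * (B + A * t) ≤ A := by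
      refine ⟨-((2 * B + A) / (2 * A)), ?_, ?_⟩ <;>
      nlinarith [Int.emod_add_mul_ediv (2 * B + A) (2 * A),
        Int.emod_nonneg (2 * B + A) (by positivity : 2 * A ≠ 0),
        Int.emod_lt_of_pos (2 * B + A) (by positivity : 0 < 2 * A)]
    set B' := B + A * t with hB'
    set C' := A * t ^ 2 + 2 * B * t + C with hC'
    have hdet : A * C' - B' ^ 2 = D := by rw [← h]; ring
    have hC'pos : 0 < C' := by
      by_contra! hc
      nlinarith [sq_nonneg B', mul_nonneg hA.le (neg_nonneg.2 hc)]
    have hlt : C' < A := by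
      by_contra! hc
      nlinarith [mul_le_mul_of_nonneg_left hc hA.le, sq_abs B',
        mul_nonneg (sub_nonneg.2 ht₁) (sub_nonneg.2 ht₂)]
    obtain ⟨p, q, r, s, hps, hpos, hle⟩ := ih C'.toNat (by omega) C' (-B') A hC'pos
      (by rw [← hdet]; ring) rfl
    have key : A * (t * p - r) ^ 2 + 2 * B * (t * p - r) * p + C * p ^ 2 =
        C' * p ^ 2 + 2 * (-B') * p * r + A * r ^ 2 := by
      rw [hB', hC']; ring
    exact ⟨t * p - r, t * q - s, p, q, by linear_combination hps, key ▸ hpos, key ▸ hle⟩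

/-- A positive definite integral ternary form of determinant one only takes values that are sums
of three squares. -/
theorem sum_three_sq_of_ternary_form_det_one (a b c d e f : ℤ) (ha : 0 < a)
    (hab : 0 < a * b - f ^ 2)
    (hdet : a * b * c + 2 * d * e * f - a * d ^ 2 - b * e ^ 2 - c * f ^ 2 = 1) (x y z : ℤ) :
    ∃ u v w : ℤ, a * x ^ 2 + b * y ^ 2 + c * z ^ 2 + 2 * d * y * z + 2 * e * x * z +
      2 * f * x * y = u ^ 2 + v ^ 2 + w ^ 2 := by
  induction hn : a.toNat using Nat.strong_induction_on generalizing a b c d e f x y z with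
  | _ n ih =>
    obtain ⟨p, q, r, s, hps, hpos, hle⟩ := exists_reduced_binary_form (a * b - f ^ 2)
      (a * d - e * f) (a * c - e ^ 2) a hab ha (by linear_combination a * hdet)
    obtain ⟨t, ht₁, ht₂⟩ : ∃ t : ℤ, -a ≤ 2 * (f * p + e * r + a * t) ∧
        2 * (f * p + e * r + a * t) ≤ a := by
      refine ⟨-((2 * (f * p + e * r) + a) / (2 * a)), ?_, ?_⟩ <;>
      nlinarith [Int.emod_add_mul_ediv (2 * (f * p + e * r) + a) (2 * a),
        Int.emod_nonneg (2 * (f * p + e * r) + a) (by positivity : 2 * a ≠ 0),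
        Int.emod_lt_of_pos (2 * (f * p + e * r) + a) (by positivity : 0 < 2 * a)]
    -- coefficients after `x ↦ x + t y`, `y ↦ p y + q z`, `z ↦ r y + s z`
    set f' := f * p + e * r + a * t with hf'
    set e' := f * q + e * s with he'
    set b' := a * t ^ 2 + b * p ^ 2 + c * r ^ 2 + 2 * d * p * r + 2 * e * t * r + 2 * f * t * p
      with hb'
    set c' := b * q ^ 2 + c * s ^ 2 + 2 * d * q * s with hc'
    set d' := b * p * q + c * r * s + d * (p * s + q * r) + e * t * s + f * t * q with hd'
    set g := (a * b - f ^ 2) * p ^ 2 + 2 * (a * d - e * f) * p * r + (a * c - e ^ 2) * r ^ 2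
      with hg
    have hg' : a * b' - f' ^ 2 = g := by rw [hf', hb', hg]; ring
    have hdet' : a * b' * c' + 2 * d' * e' * f' - a * d' ^ 2 - b' * e' ^ 2 - c' * f' ^ 2 = 1 := by
      have : a * b' * c' + 2 * d' * e' * f' - a * d' ^ 2 - b' * e' ^ 2 - c' * f' ^ 2 =
          (a * b * c + 2 * d * e * f - a * d ^ 2 - b * e ^ 2 - c * f ^ 2) *
            (p * s - q * r) ^ 2 := by
        rw [hf', hb', hc', hd', he']; ring
      rw [this, hdet, hps]; norm_num
    obtain ⟨X, Y, Z, hXYZ⟩ : ∃ X Y Z : ℤ, x = X + t * Y ∧ y = p * Y + q * Z ∧ z = r * Y + s * Z :=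
      ⟨x - t * (s * y - q * z), s * y - q * z, p * z - r * y, by ring,
        by linear_combination (-y) * hps, by linear_combination (-z) * hps⟩
    obtain ⟨rfl, rfl, rfl⟩ := hXYZ
    have hval : a * (X + t * Y) ^ 2 + b * (p * Y + q * Z) ^ 2 + c * (r * Y + s * Z) ^ 2 +
        2 * d * (p * Y + q * Z) * (r * Y + s * Z) + 2 * e * (X + t * Y) * (r * Y + s * Z) +
        2 * f * (X + t * Y) * (p * Y + q * Z) =
        b' * Y ^ 2 + a * X ^ 2 + c' * Z ^ 2 + 2 * e' * X * Z + 2 * d' * Y * Z +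
          2 * f' * Y * X := by
      rw [hf', hb', hc', hd', he']; ring
    rw [hval]
    clear_value f' e' b' c' d' g
    clear hval hf' he' hb' hc' hd' hg hps hdet hab
    have hb'pos : 0 < b' := by
      by_contra! hb
      nlinarith [sq_nonneg f', mul_nonneg ha.le (neg_nonneg.2 hb)]
    obtain rfl | ha2 : a = 1 ∨ 2 ≤ a := by omega
    · obtain rfl : f' = 0 := by omega
      obtain rfl : b' = 1 := by nlinarith
      exact ⟨X + e' * Z, Y + d' * Z, Z, by linear_combination Z ^ 2 * hdet'⟩
    · have hfsq : 4 * f' ^ 2 ≤ a ^ 2 := by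
        nlinarith [mul_nonneg (sub_nonneg.2 ht₁) (sub_nonneg.2 ht₂)]
      have hlt : b' < a := by
        by_contra! hb
        have h₁ : 3 * a ^ 2 ≤ 4 * g := by nlinarith [mul_le_mul_of_nonneg_left hb ha.le]
        have h₂ : 3 * a ≤ 2 * g := by nlinarith
        nlinarith
      exact ih b'.toNat (by omega) b' a c' e' d' f' hb'pos (by linarith)
        (by linear_combination hdet') Y X Z rfl

theorem sum_three_sq_of_dvd (n d t : ℤ) (hd : 0 < d) (hdn : 0 < d * n - 1)
    (h : d * n - 1 ∣ t ^ 2 + d) : ∃ u v w : ℤ, n = u ^ 2 + v ^ 2 + w ^ 2 := by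
  obtain ⟨a, ha⟩ := h
  have hapos : 0 < a := by
    by_contra! hc
    nlinarith [sq_nonneg t, mul_nonneg hdn.le (neg_nonneg.2 hc)]
  obtain ⟨u, v, w, huvw⟩ := sum_three_sq_of_ternary_form_det_one a (d * n - 1) n 0 1 t hapos
    (by nlinarith) (by linear_combination (-n) * ha) 0 0 1
  exact ⟨u, v, w, by rw [← huvw]; ring⟩

theorem exists_prime_dvd_sq_add {p d : ℕ} (hp : p.Prime) (h : jacobiSym (-d) p = 1) :
    ∃ t : ℤ, (p : ℤ) ∣ t ^ 2 + d := by
  have := Fact.mk hp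
  rw [← jacobiSym.legendreSym.to_jacobiSym] at h
  have h0 : ((-d : ℤ) : ZMod p) ≠ 0 := by
    intro h0
    rw [(legendreSym.eq_zero_iff p _).2 h0] at h
    exact zero_ne_one h
  obtain ⟨s, hs⟩ := (legendreSym.eq_one_iff p h0).1 h
  obtain ⟨t, rfl⟩ := ZMod.intCast_surjective s
  refine ⟨t, (ZMod.intCast_zmod_eq_zero_iff_dvd _ p).1 ?_⟩
  push_cast at hs ⊢
  linear_combination -hs

theorem sum_three_sq_of_mod_four_eq_two (n : ℕ) (hn : n % 4 = 2) :
    ∃ u v w : ℤ, (n : ℤ) = u ^ 2 + v ^ 2 + w ^ 2 := by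
  have hcop : (n - 1).Coprime (4 * n) := by
    refine Nat.Coprime.mul_right ?_ ?_
    · exact Nat.Coprime.pow_right 2 (Nat.coprime_two_right.2 (by grind))
    · exact (Nat.coprime_self_sub_left (by omega)).2 (Nat.coprime_one_left n)
  obtain ⟨p, hpgt, hp, hpmod⟩ :=
    Nat.forall_exists_prime_gt_and_modEq (4 * n) (by omega) hcop
  obtain ⟨j, hj⟩ := (Nat.modEq_iff_dvd' (by omega)).1 hpmod.symm
  set d := 4 * j + 1 with hd
  have hpd : p + 1 = d * n := by
    have : d * n = 4 * n * j + n := by rw [hd]; ring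
    omega
  have hdodd : Odd d := ⟨2 * j, by omega⟩
  have hp4 : p % 4 = 1 := by
    have : p = 4 * (n * j) + (n - 1) := by rw [← mul_assoc]; omega
    omega
  have hjac : jacobiSym (-d) p = 1 := by
    have hpodd : Odd p := Nat.odd_iff.2 (by omega)
    rw [jacobiSym.neg _ hpodd, ZMod.χ₄_nat_one_mod_four hp4, one_mul,
      jacobiSym.quadratic_reciprocity_one_mod_four' hdodd hp4,
      jacobiSym.mod_left' (a₂ := -1), jacobiSym.at_neg_one hdodd,
      ZMod.χ₄_nat_one_mod_four (by omega)]
    refine Int.ModEq.symm (Int.modEq_iff_dvd.2 ⟨n, ?_⟩)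
    have : (p : ℤ) + 1 = d * n := by exact_mod_cast hpd
    linear_combination this
  obtain ⟨t, ht⟩ := exists_prime_dvd_sq_add hp hjac
  have hpd' : (d : ℤ) * n - 1 = p := by
    have : (p : ℤ) + 1 = d * n := by exact_mod_cast hpd
    linarith
  exact sum_three_sq_of_dvd n d t (by omega) (by rw [hpd']; exact_mod_cast hp.pos)
    (by rwa [hpd'])

theorem sum_three_sq_of_odd (n : ℕ) (hn : n % 8 = 1 ∨ n % 8 = 3 ∨ n % 8 = 5) :
    ∃ u v w : ℤ, (n : ℤ) = u ^ 2 + v ^ 2 + w ^ 2 := by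
  obtain ⟨c, hc, hcn⟩ : ∃ c : ℕ, (c = 1 ∨ c = 3) ∧
      ((c * n) % 8 = 3 ∨ (c * n) % 8 = 7 ∧ c = 3) := by
    obtain h | h | h := hn
    · exact ⟨3, by omega⟩
    · exact ⟨1, by omega⟩
    · exact ⟨3, by omega⟩
  obtain ⟨r, hr⟩ : ∃ r, c * n = 2 * r + 1 := ⟨c * n / 2, by omega⟩
  have hcop : r.Coprime (4 * n) := by
    refine Nat.Coprime.mul_right ?_ ?_
    · exact Nat.Coprime.pow_right 2 (Nat.coprime_two_right.2 (Nat.odd_iff.2 (by omega)))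
    · refine Nat.Coprime.coprime_mul_left_right (k := c) ?_
      rw [hr]
      simp
  obtain ⟨p, hpgt, hp, hpmod⟩ :=
    Nat.forall_exists_prime_gt_and_modEq r (by omega) hcop
  obtain ⟨j, hj⟩ := (Nat.modEq_iff_dvd' hpgt.le).1 hpmod.symm
  set d := 8 * j + c with hd
  have hpd : 2 * p + 1 = d * n := by
    have : d * n = 2 * (4 * n * j) + c * n := by rw [hd]; ring
    omega
  have hdodd : Odd d := Nat.odd_iff.2 (by omega)
  have hp4 : p % 4 = r % 4 := by
    have : p = 4 * (n * j) + r := by rw [← mul_assoc]; omega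
    omega
  have hpodd : Odd p := Nat.odd_iff.2 (by omega)
  have hrec : jacobiSym (-d) p = jacobiSym p d := by
    rw [jacobiSym.neg _ hpodd]
    obtain h | ⟨h, rfl⟩ := hcn
    · rw [ZMod.χ₄_nat_one_mod_four (by omega), one_mul,
        jacobiSym.quadratic_reciprocity_one_mod_four' hdodd (by omega)]
    · rw [ZMod.χ₄_nat_three_mod_four (by omega),
        jacobiSym.quadratic_reciprocity_three_mod_four (by omega) (by omega)]
      ring
  have hjac : jacobiSym (-d) p = 1 := by
    have hneg : jacobiSym (-2) d = 1 := by
      rw [jacobiSym.at_neg_two hdodd, ZMod.χ₈'_nat_eq_if_mod_eight]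
      have : d % 8 = c := by omega
      rcases hc with rfl | rfl <;> simp [this] <;> omega
    have hprod : jacobiSym (-2) d * jacobiSym p d = 1 := by
      rw [← jacobiSym.mul_left, jacobiSym.mod_left' (a₂ := 1), jacobiSym.one_left]
      refine Int.ModEq.symm (Int.modEq_iff_dvd.2 ⟨-n, ?_⟩)
      have : 2 * (p : ℤ) + 1 = d * n := by exact_mod_cast hpd
      linear_combination -this
    rw [hrec]
    rwa [hneg, one_mul] at hprod
  obtain ⟨t, ht, ht2⟩ : ∃ t : ℤ, (p : ℤ) ∣ t ^ 2 + d ∧ t % 2 = 1 := by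
    obtain ⟨t, ht⟩ := exists_prime_dvd_sq_add hp hjac
    obtain h | h := Int.emod_two_eq_zero_or_one t
    · refine ⟨t + p, ?_, by grind⟩
      rw [show (t + p) ^ 2 + (d : ℤ) = (t ^ 2 + d) + p * (2 * t + p) by ring]
      exact dvd_add ht (dvd_mul_right _ _)
    · exact ⟨t, ht, h⟩
  have h2 : (2 : ℤ) ∣ t ^ 2 + d := by
    obtain ⟨e, he⟩ := hdodd
    obtain ⟨k, rfl⟩ : ∃ k, t = 2 * k + 1 := ⟨t / 2, by omega⟩
    exact ⟨2 * k ^ 2 + 2 * k + 1 + e, by rw [he]; push_cast; ring⟩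
  have hpd' : (d : ℤ) * n - 1 = 2 * p := by
    have : 2 * (p : ℤ) + 1 = d * n := by exact_mod_cast hpd
    linarith
  refine sum_three_sq_of_dvd n d t (by omega) (by have := hp.pos; omega) ?_
  rw [hpd']
  refine IsCoprime.mul_dvd ?_ h2 ht
  exact_mod_cast Nat.isCoprime_iff_coprime.2 (Nat.coprime_two_left.2 hpodd)

theorem sum_three_sq_of_ne (n : ℕ) (h : ¬ ∃ k l : ℕ, n = 4 ^ k * (8 * l + 7)) :
    ∃ u v w : ℤ, (n : ℤ) = u ^ 2 + v ^ 2 + w ^ 2 := by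
  induction n using Nat.strong_induction_on with
  | _ n ih =>
    obtain rfl | hpos := n.eq_zero_or_pos
    · exact ⟨0, 0, 0, by norm_num⟩
    by_cases h4 : n % 4 = 0
    · obtain ⟨m, rfl⟩ := Nat.dvd_of_mod_eq_zero h4
      obtain ⟨u, v, w, huvw⟩ := ih m (by omega) fun ⟨k, l, hkl⟩ ↦
        h ⟨k + 1, l, by rw [hkl]; ring⟩
      exact ⟨2 * u, 2 * v, 2 * w, by push_cast; linear_combination 4 * huvw⟩
    · have h7 : n % 8 ≠ 7 := fun h7 ↦ h ⟨0, n / 8, by omega⟩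
      by_cases h2 : n % 4 = 2
      · exact sum_three_sq_of_mod_four_eq_two n h2
      · exact sum_three_sq_of_odd n (by omega)

theorem sum_three_sq_ne (k l : ℕ) (u v w : ℤ) :
    u ^ 2 + v ^ 2 + w ^ 2 ≠ 4 ^ k * (8 * l + 7) := by
  have hsq (a : ℤ) : a ^ 2 % 8 = 0 ∧ a % 2 = 0 ∨ a ^ 2 % 8 = 4 ∧ a % 2 = 0 ∨
      a ^ 2 % 8 = 1 ∧ a % 2 = 1 := by
    have : a % 8 = 0 ∨ a % 8 = 1 ∨ a % 8 = 2 ∨ a % 8 = 3 ∨ a % 8 = 4 ∨ a % 8 = 5 ∨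
      a % 8 = 6 ∨ a % 8 = 7 := by omega
    rcases this with h | h | h | h | h | h | h | h <;> simp [pow_two, Int.mul_emod, h] <;> omega
  induction k generalizing u v w with
  | zero =>
    intro h
    have := hsq u
    have := hsq v
    have := hsq w
    omega
  | succ k ih =>
    intro h
    have h4 : u ^ 2 + v ^ 2 + w ^ 2 = 4 * (4 ^ k * (8 * l + 7)) := by rw [h]; ring
    have hu := hsq u
    have hv := hsq v
    have hw := hsq w
    obtain ⟨u, rfl⟩ : (2 : ℤ) ∣ u := by omega
    obtain ⟨v, rfl⟩ : (2 : ℤ) ∣ v := by omega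
    obtain ⟨w, rfl⟩ : (2 : ℤ) ∣ w := by omega
    exact ih u v w (by linarith)

theorem exists_sq_add_two_sq_add_two_sq {u v w n : ℤ} (h : n = u ^ 2 + v ^ 2 + w ^ 2) :
    ∃ x y z : ℤ, x ^ 2 + 2 * y ^ 2 + 2 * z ^ 2 = n := by
  have key {a b c : ℤ} (hn : n = a ^ 2 + b ^ 2 + c ^ 2) (hab : 2 ∣ a - b) :
      ∃ x y z : ℤ, x ^ 2 + 2 * y ^ 2 + 2 * z ^ 2 = n := by
    obtain ⟨k, hk⟩ := hab
    obtain rfl : a = b + 2 * k := by omega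
    exact ⟨c, b + k, k, by rw [hn]; ring⟩
  obtain hp | hp | hp : (2 : ℤ) ∣ u - v ∨ (2 : ℤ) ∣ u - w ∨ (2 : ℤ) ∣ v - w := by omega
  · exact key h hp
  · exact key (c := v) (by linarith) hp
  · exact key (c := u) (by linarith) hp

theorem rep_x2_2y2_4z2 (m : ℤ) (hm : 0 < m) :
    (∃ x y z : ℤ, x ^ 2 + 2 * y ^ 2 + 4 * z ^ 2 = m) ↔
      ¬ ∃ k l : ℕ, m = 4 ^ k * (16 * l + 14) := by
  constructor
  · rintro ⟨x, y, z, h⟩ ⟨k, l, rfl⟩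
    have h2 : (2 : ℤ) ∣ x ^ 2 :=
      ⟨4 ^ k * (8 * l + 7) - y ^ 2 - 2 * z ^ 2, by linarith⟩
    obtain ⟨x, rfl⟩ := Int.prime_two.dvd_of_dvd_pow h2
    exact sum_three_sq_ne k l y (x + z) (x - z) (by linarith)
  · intro h
    lift m to ℕ using hm.le
    obtain ⟨n, rfl | rfl⟩ := Nat.even_or_odd' m
    · obtain ⟨u, v, w, huvw⟩ := sum_three_sq_of_ne n fun ⟨k, l, hkl⟩ ↦
        h ⟨k, l, by rw [hkl]; push_cast; ring⟩
      obtain ⟨x, y, z, h⟩ := exists_sq_add_two_sq_add_two_sq huvw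
      exact ⟨2 * y, x, z, by push_cast; linarith⟩
    · obtain ⟨u, v, w, huvw⟩ :=
        sum_three_sq_of_mod_four_eq_two (2 * (2 * n + 1)) (by omega)
      obtain ⟨x, y, z, h⟩ := exists_sq_add_two_sq_add_two_sq huvw
      push_cast at h ⊢
      have h2 : (2 : ℤ) ∣ x ^ 2 := ⟨2 * n + 1 - y ^ 2 - z ^ 2, by linarith⟩
      obtain ⟨x, rfl⟩ := Int.prime_two.dvd_of_dvd_pow h2
      have hyz : (2 : ℤ) ∣ y * z := by
        by_contra hyz
        rw [← even_iff_two_dvd, Int.not_even_iff_odd, Int.odd_mul] at hyz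
        obtain ⟨⟨a, rfl⟩, b, rfl⟩ := hyz
        ring_nf at h
        omega
      obtain ⟨a, rfl⟩ | ⟨a, rfl⟩ := Int.prime_two.dvd_or_dvd hyz
      · exact ⟨z, x, a, by linarith⟩
      · exact ⟨y, x, a, by linarith⟩
end

section
/- A positive integer m is represented by the quadratic form x^2 + 2y^2 + 5z^2 (i.e., there exist integers x, y, z with x^2 + 2y^2 + 5z^2 = m) if and only if m is not of the form 25^k(25ℓ + 10) and not of the form 25^k(25ℓ - 10) for any nonnegative integers k and ℓ. -/
/-- A form of Dirichlet's theorem on primes in arithmetic progressions. -/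
theorem exists_prime_mul_eq_add_mul {u v w : ℤ} (hu : 0 < u) (hw : IsCoprime w u)
    (hv : IsCoprime v u) (N : ℕ) :
    ∃ p : ℕ, p.Prime ∧ N < p ∧ ∃ k : ℤ, w * p = v + u * k := by
  lift u to ℕ using hu.le
  obtain ⟨i, j, hij⟩ := hw
  have hi : IsCoprime (v * i) u := hv.mul_left ⟨w, j, by linear_combination hij⟩
  obtain ⟨p, hpN, hp, hpv⟩ := Nat.forall_exists_prime_gt_and_zmodEq N (by omega) hi
  obtain ⟨k, hk⟩ := Int.modEq_iff_dvd.1 hpv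
  exact ⟨p, hp, hpN, -j * v - w * k, by linear_combination v * hij - w * hk⟩

theorem jacobiSym_eq_one_of_sq_mul_eq {a p t : ℤ} {b : ℕ} (hab : jacobiSym a b = 1)
    (h : (b : ℤ) ∣ t ^ 2 * p - a) : jacobiSym p b = 1 := by
  have h1 : jacobiSym (t ^ 2 * p) b = 1 :=
    (jacobiSym.mod_left' (Int.modEq_iff_dvd.2 h)).symm.trans hab
  rw [jacobiSym.mul_left, jacobiSym.pow_left] at h1
  rcases jacobiSym.trichotomy t b with h | h | h <;> simp_all

theorem exists_dvd_sq_add {p : ℕ} (hp : p.Prime) {a : ℤ} (h : jacobiSym (-a) p = 1) :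
    ∃ r : ℤ, (p : ℤ) ∣ r ^ 2 + a := by
  have := Fact.mk hp
  obtain ⟨r, hr⟩ := ZMod.isSquare_of_jacobiSym_eq_one h
  refine ⟨r.val, (ZMod.intCast_zmod_eq_zero_iff_dvd _ _).1 ?_⟩
  push_cast at hr ⊢
  rw [ZMod.natCast_zmod_val]
  linear_combination -hr

theorem jacobiSym_neg_eq_one_of_mod_eight {b p : ℕ} {m t : ℤ} (hp : p % 2 = 1) (hb8 : b % 8 = 7)
    (hb5 : b % 5 = 2 ∨ b % 5 = 3) (h : b * m - t ^ 2 * p = 10) :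
    jacobiSym (-b) p = 1 := by
  have h10 : jacobiSym (-10) b = 1 := by
    rw [jacobiSym.mod_right _ (Nat.odd_iff.2 (by omega))]
    have : b % 40 = 7 ∨ b % 40 = 23 := by omega
    rcases this with h | h <;> (simp [h]; try norm_num)
  have hpb : jacobiSym p b = 1 :=
    jacobiSym_eq_one_of_sq_mul_eq h10 (t := t) ⟨m, by linarith⟩
  have hpo := Nat.odd_iff.2 hp
  rw [jacobiSym.neg _ hpo]
  rcases (by omega : p % 4 = 1 ∨ p % 4 = 3) with h4 | h4
  · rw [ZMod.χ₄_nat_one_mod_four h4, one_mul,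
      jacobiSym.quadratic_reciprocity_one_mod_four' (Nat.odd_iff.2 (by omega)) h4, hpb]
  · rw [ZMod.χ₄_nat_three_mod_four h4,
      jacobiSym.quadratic_reciprocity_three_mod_four (by omega) h4, hpb]
    norm_num

theorem jacobiSym_neg_two_mul_eq_one {c p : ℕ} {m t : ℤ} (hp : p % 8 = 1) (hc4 : c % 4 = 1)
    (hc5 : c % 5 = 1 ∨ c % 5 = 4) (h : c * m - t ^ 2 * p = 5) :
    jacobiSym (-(2 * c)) p = 1 := by
  have h5 : jacobiSym (-5) c = 1 := by
    rw [jacobiSym.mod_right _ (Nat.odd_iff.2 (by omega))]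
    have : c % 20 = 1 ∨ c % 20 = 9 := by omega
    rcases this with h | h <;> (simp [h]; try norm_num)
  have hpc : jacobiSym p c = 1 :=
    jacobiSym_eq_one_of_sq_mul_eq h5 (t := t) ⟨m, by linarith⟩
  have h2 : jacobiSym (-2) p = 1 := by
    rw [jacobiSym.mod_right _ (Nat.odd_iff.2 (by omega))]
    simp [hp]
  rw [← neg_mul, jacobiSym.mul_left, h2, one_mul,
    jacobiSym.quadratic_reciprocity_one_mod_four' (Nat.odd_iff.2 (by omega)) (by omega), hpc]

/-- `S` is the set of values of the positive definite ternary form of determinant `10` whose Gram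
matrix is `!![a, d, e; d, b, g; e, g, c]`. -/
structure IsGramOfValues (S : Set ℤ) (a b c d e g : ℤ) : Prop where
  pos : 0 < a
  minor_pos : 0 < a * b - d ^ 2
  det : a * b * c + 2 * d * e * g - a * g ^ 2 - b * e ^ 2 - c * d ^ 2 = 10
  mem_iff : ∀ n, n ∈ S ↔ ∃ x y z : ℤ,
    a * x ^ 2 + b * y ^ 2 + c * z ^ 2 + 2 * d * x * y + 2 * e * x * z + 2 * g * y * z = n

namespace IsGramOfValues

variable {S : Set ℤ} {a b c d e g : ℤ}

theorem second_pos (h : IsGramOfValues S a b c d e g) : 0 < b :=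
  pos_of_mul_pos_right (by nlinarith [h.minor_pos, sq_nonneg d]) h.pos.le

theorem minor_mul_minor (h : IsGramOfValues S a b c d e g) :
    (a * b - d ^ 2) * (a * c - e ^ 2) - (a * g - d * e) ^ 2 = 10 * a := by
  linear_combination a * h.det

theorem swap_fst_snd (h : IsGramOfValues S a b c d e g) : IsGramOfValues S b a c d g e where
  pos := h.second_pos
  minor_pos := by linarith [h.minor_pos]
  det := by linarith [h.det]
  mem_iff n := by
    rw [h.mem_iff]
    constructor <;> rintro ⟨x, y, z, rfl⟩ <;> exact ⟨y, x, z, by ring⟩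

theorem swap_snd_trd (h : IsGramOfValues S a b c d e g) : IsGramOfValues S a c b e d g where
  pos := h.pos
  minor_pos := by
    have := h.pos
    have := h.minor_mul_minor
    exact pos_of_mul_pos_right (by linarith [sq_nonneg (a * g - d * e)]) h.minor_pos.le
  det := by linarith [h.det]
  mem_iff n := by
    rw [h.mem_iff]
    constructor <;> rintro ⟨x, y, z, rfl⟩ <;> exact ⟨x, z, y, by ring⟩

theorem add_fst_snd (h : IsGramOfValues S a b c d e g) (k : ℤ) :
    IsGramOfValues S a (b + 2 * k * d + k ^ 2 * a) c (d + k * a) e (g + k * e) where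
  pos := h.pos
  minor_pos := by linarith [h.minor_pos]
  det := by linarith [h.det]
  mem_iff n := by
    rw [h.mem_iff]
    constructor
    · rintro ⟨x, y, z, rfl⟩
      exact ⟨x - k * y, y, z, by ring⟩
    · rintro ⟨x, y, z, rfl⟩
      exact ⟨x + k * y, y, z, by ring⟩

theorem add_fst_trd (h : IsGramOfValues S a b c d e g) (k : ℤ) :
    IsGramOfValues S a b (c + 2 * k * e + k ^ 2 * a) d (e + k * a) (g + k * d) where
  pos := h.pos
  minor_pos := h.minor_pos
  det := by linarith [h.det]
  mem_iff n := by
    rw [h.mem_iff]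
    constructor
    · rintro ⟨x, y, z, rfl⟩
      exact ⟨x - k * z, y, z, by ring⟩
    · rintro ⟨x, y, z, rfl⟩
      exact ⟨x + k * z, y, z, by ring⟩

theorem add_snd_trd (h : IsGramOfValues S a b c d e g) (k : ℤ) :
    IsGramOfValues S a b (c + 2 * k * g + k ^ 2 * b) d (e + k * d) (g + k * b) where
  pos := h.pos
  minor_pos := h.minor_pos
  det := by linarith [h.det]
  mem_iff n := by
    rw [h.mem_iff]
    constructor
    · rintro ⟨x, y, z, rfl⟩
      exact ⟨x, y - k * z, z, by ring⟩
    · rintro ⟨x, y, z, rfl⟩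
      exact ⟨x, y + k * z, z, by ring⟩

theorem exists_abs_two_mul_add_le {n : ℤ} (hn : 0 < n) (r : ℤ) :
    ∃ k : ℤ, |2 * (r + k * n)| ≤ n := by
  refine ⟨-((2 * r + n) / (2 * n)), abs_le.2 ?_⟩
  have h1 := Int.emod_add_mul_ediv (2 * r + n) (2 * n)
  have h2 := Int.emod_nonneg (2 * r + n) (by positivity : 2 * n ≠ 0)
  have h3 := Int.emod_lt_of_pos (2 * r + n) (by positivity : 0 < 2 * n)
  constructor <;> linarith

theorem exists_reduced (h : IsGramOfValues S a b c d e g) :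
    ∃ a b c d e g, IsGramOfValues S a b c d e g ∧ a ≤ b ∧ a * b - d ^ 2 ≤ a * c - e ^ 2 ∧
      |2 * d| ≤ a ∧ |2 * e| ≤ a ∧ |2 * (a * g - d * e)| ≤ a * b - d ^ 2 := by
  classical
  have hA : ∃ A : ℕ, ∃ b c d e g, IsGramOfValues S A b c d e g := by
    refine ⟨a.toNat, b, c, d, e, g, ?_⟩
    rwa [Int.toNat_of_nonneg h.pos.le]
  have hmin {a b c d e g} (h' : IsGramOfValues S a b c d e g) : (Nat.find hA : ℤ) ≤ a := by
    have := Nat.find_min' hA (m := a.toNat)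
      ⟨b, c, d, e, g, by rwa [Int.toNat_of_nonneg h'.pos.le]⟩
    have := h'.pos
    omega
  have hN : ∃ N : ℕ, ∃ b c d e g, IsGramOfValues S (Nat.find hA) b c d e g ∧
      Nat.find hA * b - d ^ 2 = N := by
    obtain ⟨b, c, d, e, g, h'⟩ := Nat.find_spec hA
    exact ⟨_, b, c, d, e, g, h', (Int.toNat_of_nonneg h'.minor_pos.le).symm⟩
  have hmin' {b c d e g} (h' : IsGramOfValues S (Nat.find hA) b c d e g) :
      (Nat.find hN : ℤ) ≤ Nat.find hA * b - d ^ 2 := by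
    have := Nat.find_min' hN
      ⟨b, c, d, e, g, h', (Int.toNat_of_nonneg h'.minor_pos.le).symm⟩
    have := h'.minor_pos
    omega
  obtain ⟨b, c, d, e, g, h₀, hN₀⟩ := Nat.find_spec hN
  obtain ⟨k, hk⟩ := exists_abs_two_mul_add_le h₀.minor_pos (Nat.find hA * g - d * e)
  obtain ⟨l, hl⟩ := exists_abs_two_mul_add_le h₀.pos d
  have h₁ := (h₀.add_snd_trd k).add_fst_snd l
  obtain ⟨j, hj⟩ := exists_abs_two_mul_add_le h₀.pos (e + k * d)
  have h₂ := h₁.add_fst_trd j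
  refine ⟨_, _, _, _, _, _, h₂, hmin h₂.swap_fst_snd, ?_, hl, hj, ?_⟩
  · linarith [hmin' h₂.swap_snd_trd]
  · exact (congrArg _ (by ring)).trans_le (hk.trans_eq (by ring))

/-- The possible Gram matrices of a reduced form, up to what is needed to tell apart the forms
which are odd and do not represent `10`. -/
theorem coeff_of_reduced (h : IsGramOfValues S a b c d e g) (hab : a ≤ b)
    (hminor : a * b - d ^ 2 ≤ a * c - e ^ 2) (hd : |2 * d| ≤ a) (he : |2 * e| ≤ a)
    (hB : |2 * (a * g - d * e)| ≤ a * b - d ^ 2) :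
    (a = 1 ∧ b = 2 ∧ c = 5 ∧ d = 0 ∧ e = 0 ∧ g = 0) ∨ (a = 1 ∧ b = 1 ∧ d = 0) ∨
      (a = 2 ∧ b = 2 ∧ d = 0) ∨ (a = 2 ∧ b = 2 ∧ c = 4) := by
  have hdet := h.minor_mul_minor
  have hA0 := h.minor_pos
  have ha := h.pos
  obtain ⟨A, hA⟩ : ∃ A, a * b - d ^ 2 = A := ⟨_, rfl⟩
  obtain ⟨B, hBe⟩ : ∃ B, a * g - d * e = B := ⟨_, rfl⟩
  obtain ⟨C, hC⟩ : ∃ C, a * c - e ^ 2 = C := ⟨_, rfl⟩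
  rw [hA] at hminor hB hdet hA0
  rw [hBe] at hB hdet
  rw [hC] at hminor hdet
  rw [abs_le] at hd he hB
  have hA2 : 3 * A ^ 2 ≤ 40 * a := by nlinarith
  have ha2 : 3 * a ^ 2 ≤ 4 * A := by nlinarith
  have ha3 : a ≤ 2 := by
    by_contra! h3
    have : 9 * (a ^ 2) ^ 2 ≤ 16 * A ^ 2 := by nlinarith
    have : 27 * a ^ 3 ≤ 640 := by nlinarith
    nlinarith [pow_le_pow_left₀ (by norm_num : (0:ℤ) ≤ 3) h3 3]
  have hA5 : A ≤ 5 := by nlinarith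
  obtain ⟨hd1, hd2⟩ : -1 ≤ d ∧ d ≤ 1 := by omega
  obtain ⟨he1, he2⟩ : -1 ≤ e ∧ e ≤ 1 := by omega
  obtain ⟨hB1, hB2⟩ : -2 ≤ B ∧ B ≤ 2 := by omega
  clear h
  interval_cases a <;> interval_cases A <;> try omega
  all_goals interval_cases B <;> try omega
  all_goals interval_cases d <;> try omega
  all_goals interval_cases e <;> omega

theorem eq_of_mem (h : IsGramOfValues S a b c d e g) (h10 : 10 ∉ S)
    (hodd : ∃ n ∈ S, Odd n) {m : ℤ} (hm : m ∈ S) :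
    ∃ x y z : ℤ, x ^ 2 + 2 * y ^ 2 + 5 * z ^ 2 = m := by
  obtain ⟨a, b, c, d, e, g, h, hab, hminor, hd, he, hB⟩ := h.exists_reduced
  obtain ⟨n, hnS, hn⟩ := hodd
  rcases h.coeff_of_reduced hab hminor hd he hB with ⟨rfl, rfl, rfl, rfl, rfl, rfl⟩ |
    ⟨rfl, rfl, rfl⟩ | ⟨rfl, rfl, rfl⟩ | ⟨rfl, rfl, rfl⟩
  · obtain ⟨x, y, z, rfl⟩ := (h.mem_iff m).1 hm
    exact ⟨x, y, z, by ring⟩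
  · exact absurd ((h.mem_iff 10).2 ⟨3, 1, 0, by ring⟩) h10
  · exact absurd ((h.mem_iff 10).2 ⟨2, 1, 0, by ring⟩) h10
  · obtain ⟨x, y, z, rfl⟩ := (h.mem_iff n).1 hnS
    exact absurd hn (Int.not_odd_iff_even.2
      ⟨x ^ 2 + y ^ 2 + 2 * z ^ 2 + d * x * y + e * x * z + g * y * z, by ring⟩)

end IsGramOfValues

theorem five_dvd_of_dvd_mul_sq_add_sq {b x y : ℤ} (hb : b % 5 = 2 ∨ b % 5 = 3)
    (h : 5 ∣ b * y ^ 2 + x ^ 2) : 5 ∣ x ∧ 5 ∣ y := by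
  have hx := Int.emod_nonneg x (by norm_num : (5 : ℤ) ≠ 0)
  have hx' := Int.emod_lt_of_pos x (by norm_num : (0 : ℤ) < 5)
  have hy := Int.emod_nonneg y (by norm_num : (5 : ℤ) ≠ 0)
  have hy' := Int.emod_lt_of_pos y (by norm_num : (0 : ℤ) < 5)
  simp only [Int.dvd_iff_emod_eq_zero] at *
  generalize hxr : x % 5 = r at *
  generalize hyr : y % 5 = s at *
  rcases hb with hb | hb <;> interval_cases r <;> interval_cases s <;>
    simp [pow_two, Int.add_emod, Int.mul_emod, hb, hxr, hyr] at h ⊢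

/-- A form with Gram matrix `!![a, d, t; d, b, 0; t, 0, m]` and determinant `10` whose leading
binary minor is not a square modulo `5` is equivalent to `x ^ 2 + 2 * y ^ 2 + 5 * z ^ 2`
as soon as it takes an odd value. -/
theorem exists_eq_of_gram {m t a b d q : ℤ} (hq : a * b - d ^ 2 = q) (hdet : q * m - t ^ 2 * b = 10)
    (hb : 0 < b) (hq0 : 0 < q) (hq5 : q % 5 = 2 ∨ q % 5 = 3) (hodd : Odd a ∨ Odd b ∨ Odd m) :
    ∃ x y z : ℤ, x ^ 2 + 2 * y ^ 2 + 5 * z ^ 2 = m := by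
  let S : Set ℤ := {n | ∃ x y z : ℤ,
    a * x ^ 2 + b * y ^ 2 + m * z ^ 2 + 2 * d * x * y + 2 * t * x * z + 2 * 0 * y * z = n}
  have hS : IsGramOfValues S a b m d t 0 :=
    { pos := pos_of_mul_pos_left (by linarith [sq_nonneg d]) hb.le
      minor_pos := by linarith
      det := by linear_combination hdet + m * hq
      mem_iff := fun _ => Iff.rfl }
  refine hS.eq_of_mem ?_ ?_ ⟨0, 0, 1, by ring⟩
  · rintro ⟨x, y, z, h⟩
    have hval : b * q * 10 =
        q * (b * y + d * x) ^ 2 + (q * x + b * t * z) ^ 2 + 10 * b * z ^ 2 := by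
      linear_combination -(b * q) * h + q * x ^ 2 * hq + b * z ^ 2 * hdet
    obtain ⟨⟨X, hX⟩, ⟨Y, hY⟩⟩ := five_dvd_of_dvd_mul_sq_add_sq hq5
      (x := q * x + b * t * z) (y := b * y + d * x)
      ⟨2 * b * q - 2 * b * z ^ 2, by linear_combination -hval⟩
    rw [hX, hY] at hval
    have hbq : (5 : ℤ) ∣ b * (q - z ^ 2) := by
      have : 2 * (b * (q - z ^ 2)) = 5 * (q * Y ^ 2 + X ^ 2) := by linarith
      omega
    rcases (by norm_num : Prime (5 : ℤ)).dvd_or_dvd hbq with ⟨k, hk⟩ | ⟨k, hk⟩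
    · have := (five_dvd_of_dvd_mul_sq_add_sq hq5 (x := d) (y := 1)
        ⟨k * a, by linear_combination a * hk - hq⟩).2
      omega
    · have := (five_dvd_of_dvd_mul_sq_add_sq (b := -q) (by omega) (x := z) (y := 1)
        ⟨-k, by linear_combination -hk⟩).2
      omega
  · rcases hodd with h | h | h
    · exact ⟨a, ⟨1, 0, 0, by ring⟩, h⟩
    · exact ⟨b, ⟨0, 1, 0, by ring⟩, h⟩
    · exact ⟨m, ⟨0, 0, 1, by ring⟩, h⟩

theorem exists_eq_of_prime {m t b : ℤ} {p : ℕ} (hp : p.Prime) (hp2 : 2 < p) (hm : 0 < m)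
    (h : b * m - t ^ 2 * p = 10) (hb8 : b % 8 = 7) (hb5 : b % 5 = 2 ∨ b % 5 = 3) :
    ∃ x y z : ℤ, x ^ 2 + 2 * y ^ 2 + 5 * z ^ 2 = m := by
  have hb : 0 < b := pos_of_mul_pos_left (by nlinarith [sq_nonneg t]) hm.le
  have hpo := hp.mod_two_eq_one_iff_ne_two.2 hp2.ne'
  lift b to ℕ using hb.le
  obtain ⟨r, a, ha⟩ := exists_dvd_sq_add hp
    (jacobiSym_neg_eq_one_of_mod_eight hpo (by omega) (by omega) h)
  exact exists_eq_of_gram (a := a) (d := r) (by linear_combination -ha) h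
    (by exact_mod_cast hp.pos) hb hb5 (Or.inr (Or.inl (by exact_mod_cast Nat.odd_iff.2 hpo)))

theorem exists_eq_of_two_mul_prime {m t c : ℤ} {p : ℕ} (hp : p.Prime) (hm : 0 < m)
    (h : c * m - t ^ 2 * p = 5) (hp8 : p % 8 = 1) (hc4 : c % 4 = 1)
    (hc5 : c % 5 = 1 ∨ c % 5 = 4) :
    ∃ x y z : ℤ, x ^ 2 + 2 * y ^ 2 + 5 * z ^ 2 = m := by
  have hc : 0 < c := pos_of_mul_pos_left (by nlinarith [sq_nonneg t]) hm.le
  lift c to ℕ using hc.le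
  have hpo : Odd (p : ℤ) := Int.odd_iff.2 (by omega)
  obtain ⟨r, hr⟩ := exists_dvd_sq_add hp
    (jacobiSym_neg_two_mul_eq_one hp8 (by omega) (by omega) h)
  obtain ⟨e, he⟩ : ∃ e : ℤ, (p : ℤ) ∣ (2 * e) ^ 2 + 2 * c := by
    rcases Int.even_or_odd' r with ⟨e, rfl | rfl⟩
    · exact ⟨e, hr⟩
    · obtain ⟨s, hs⟩ := hpo
      obtain ⟨k, hk⟩ := hr
      exact ⟨e + s + 1, k + 2 * (2 * e + 1) + p, by
        linear_combination hk - (2 * (2 * e + 1) + p + (2 * s + 1)) * hs⟩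
  have he' : (p : ℤ) ∣ 2 * (2 * e ^ 2 + c) := by convert he using 1; ring
  obtain ⟨a, ha⟩ := (Int.isCoprime_two_right.2 hpo).dvd_of_dvd_mul_left he'
  refine exists_eq_of_gram (q := 2 * c) (a := a) (b := 2 * p) (d := 2 * e) (t := t)
    (by linear_combination -2 * ha) (by linear_combination 2 * h)
    (by have := hp.pos; positivity) (by positivity) (by omega) (Or.inl ?_)
  have : Odd (p * a : ℤ) := ha ▸ Int.odd_iff.2 (by omega)
  exact (Int.odd_mul.1 this).2

theorem Int.isCoprime_five_right {n : ℤ} : IsCoprime n 5 ↔ n % 5 ≠ 0 := by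
  rw [isCoprime_comm, (Int.prime_iff_natAbs_prime.2 (by norm_num)).coprime_iff_not_dvd,
    Int.dvd_iff_emod_eq_zero]

theorem Int.isCoprime_four_right {n : ℤ} : IsCoprime n 4 ↔ Odd n := by
  rw [show (4 : ℤ) = 2 ^ 2 by norm_num, IsCoprime.pow_right_iff two_pos, Int.isCoprime_two_right]

theorem Int.isCoprime_eight_right {n : ℤ} : IsCoprime n 8 ↔ Odd n := by
  rw [show (8 : ℤ) = 2 ^ 3 by norm_num, IsCoprime.pow_right_iff three_pos, Int.isCoprime_two_right]

theorem IsCoprime.of_eq_mul_add {r v n k : ℤ} (s : ℤ) (h : IsCoprime r n)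
    (hv : s * v = k * n + r) : IsCoprime v n := by
  obtain ⟨i, j, hij⟩ := h
  exact ⟨i * s, j - i * k, by linear_combination hij + i * hv⟩

theorem exists_eq_of_odd {m : ℤ} (hm : 0 < m) (hodd : m % 2 = 1)
    (h5 : m % 5 ≠ 0 ∨ m % 25 = 5 ∨ m % 25 = 20) :
    ∃ x y z : ℤ, x ^ 2 + 2 * y ^ 2 + 5 * z ^ 2 = m := by
  by_cases hm5 : m % 5 = 0
  · obtain ⟨n, rfl⟩ := Int.dvd_of_emod_eq_zero hm5
    obtain ⟨p, hp, hp2, k, hk⟩ := exists_prime_mul_eq_add_mul (u := 8 * n) (v := 7 * n - 2) (w := 5)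
      (by omega)
      (.mul_right (by norm_num) (Int.isCoprime_five_right.2 (by omega)).symm)
      (.mul_right (Int.isCoprime_eight_right.2 (Int.odd_iff.2 (by omega)))
        (.of_eq_mul_add (k := -7) (r := 2) (-1)
          (Int.isCoprime_two_right.2 (Int.odd_iff.2 (by omega))).symm (by ring))) 2
    have hbn : (8 * k + 7) * n % 5 = 2 := by
      rw [show (8 * k + 7) * n = 5 * p + 2 by linear_combination -hk]
      omega
    refine exists_eq_of_prime hp hp2 hm (t := 5) (b := 8 * k + 7)
      (by linear_combination -5 * hk) (by omega) ?_
    rw [Int.mul_emod] at hbn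
    rcases (by omega : n % 5 = 1 ∨ n % 5 = 4) with h | h <;> rw [h] at hbn <;> omega
  · obtain ⟨p, hp, hp2, k, hk⟩ := exists_prime_mul_eq_add_mul (u := 8 * (5 * m)) (v := 7 * m - 10)
      (w := 1) (by omega) isCoprime_one_left
      (.mul_right (Int.isCoprime_eight_right.2 (Int.odd_iff.2 (by omega)))
        (.mul_right (Int.isCoprime_five_right.2 (by omega))
          (.of_eq_mul_add (k := -7) (r := 2 * 5) (-1)
            (.mul_left (Int.isCoprime_two_right.2 (Int.odd_iff.2 (by omega))).symm
              (Int.isCoprime_five_right.2 hm5).symm) (by ring)))) 2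
    exact exists_eq_of_prime hp hp2 hm (t := 1) (b := 40 * k + 7)
      (by linear_combination -hk) (by omega) (by omega)

theorem exists_eq_of_mod_eight_eq_two {m : ℤ} (hm : 0 < m) (hm8 : m % 8 = 2)
    (h5 : m % 5 ≠ 0 ∨ m % 25 = 5 ∨ m % 25 = 20) :
    ∃ x y z : ℤ, x ^ 2 + 2 * y ^ 2 + 5 * z ^ 2 = m := by
  by_cases hm5 : m % 5 = 0
  · obtain ⟨n, rfl⟩ : (10 : ℤ) ∣ m := by omega
    obtain ⟨v, hv⟩ : ∃ v, 2 * v = 7 * n - 1 := ⟨(7 * n - 1) / 2, by omega⟩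
    obtain ⟨p, hp, hp2, k, hk⟩ := exists_prime_mul_eq_add_mul (u := 4 * n) (v := v) (w := 5)
      (by omega)
      (.mul_right (by norm_num) (Int.isCoprime_five_right.2 (by omega)).symm)
      (.mul_right (Int.isCoprime_four_right.2 (Int.odd_iff.2 (by omega)))
        (.of_eq_mul_add (k := 7) (r := -1) 2 isCoprime_one_left.neg_left
          (by linear_combination hv))) 2
    have hbn : (8 * k + 7) * n % 5 = 1 := by
      rw [show (8 * k + 7) * n = 10 * p + 1 by linear_combination -2 * hk - hv]
      omega
    refine exists_eq_of_prime hp hp2 hm (t := 10) (b := 8 * k + 7)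
      (by linear_combination -20 * hk - 10 * hv) (by omega) ?_
    rw [Int.mul_emod] at hbn
    rcases (by omega : n % 5 = 2 ∨ n % 5 = 3) with h | h <;> rw [h] at hbn <;> omega
  · obtain ⟨n, rfl⟩ : (2 : ℤ) ∣ m := by omega
    obtain ⟨v, hv⟩ : ∃ v, 2 * v = 7 * n - 5 := ⟨(7 * n - 5) / 2, by omega⟩
    have hn5 := Int.isCoprime_five_right.2 (by omega : n % 5 ≠ 0)
    obtain ⟨p, hp, hp2, k, hk⟩ := exists_prime_mul_eq_add_mul (u := 4 * (5 * n)) (v := v)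
      (w := 1) (by omega) isCoprime_one_left
      (.mul_right (Int.isCoprime_four_right.2 (Int.odd_iff.2 (by omega)))
        (.mul_right (Int.isCoprime_five_right.2 (by omega))
          (.of_eq_mul_add (k := 7) (r := -5) 2 hn5.symm.neg_left (by linear_combination hv)))) 2
    exact exists_eq_of_prime hp hp2 hm (t := 2) (b := 40 * k + 7)
      (by linear_combination -4 * hk - 2 * hv) (by omega) (by omega)

theorem exists_eq_of_mod_eight_eq_six {m : ℤ} (hm : 0 < m) (hm8 : m % 8 = 6)
    (h5 : m % 5 ≠ 0 ∨ m % 25 = 5 ∨ m % 25 = 20) :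
    ∃ x y z : ℤ, x ^ 2 + 2 * y ^ 2 + 5 * z ^ 2 = m := by
  by_cases hm5 : m % 5 = 0
  · obtain ⟨n, rfl⟩ := Int.dvd_of_emod_eq_zero hm5
    obtain ⟨p, hp, -, k, hk⟩ := exists_prime_mul_eq_add_mul (u := 4 * n) (v := n - 1) (w := 5)
      (by omega)
      (.mul_right (by norm_num) (Int.isCoprime_five_right.2 (by omega)).symm)
      (.mul_right (Int.isCoprime_four_right.2 (Int.odd_iff.2 (by omega)))
        (.of_eq_mul_add (k := -1) (r := 1) (-1) isCoprime_one_left (by ring))) 2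
    have hcn : (4 * k + 1) * n % 5 = 1 := by
      rw [show (4 * k + 1) * n = 5 * p + 1 by linear_combination -hk]
      omega
    have hp8 : p % 8 = 1 := by
      obtain ⟨j, rfl⟩ : (2 : ℤ) ∣ n := by omega
      have : (4 * (2 * j) * k) = 8 * (j * k) := by ring
      omega
    refine exists_eq_of_two_mul_prime hp hm (t := 5) (c := 4 * k + 1)
      (by linear_combination -5 * hk) hp8 (by omega) ?_
    rw [Int.mul_emod] at hcn
    rcases (by omega : n % 5 = 1 ∨ n % 5 = 4) with h | h <;> rw [h] at hcn <;> omega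
  · obtain ⟨p, hp, -, k, hk⟩ := exists_prime_mul_eq_add_mul (u := 4 * (5 * m)) (v := m - 5)
      (w := 1) (by omega) isCoprime_one_left
      (.mul_right (Int.isCoprime_four_right.2 (Int.odd_iff.2 (by omega)))
        (.mul_right (Int.isCoprime_five_right.2 (by omega))
          (.of_eq_mul_add (k := -1) (r := 5) (-1) (Int.isCoprime_five_right.2 hm5).symm
            (by ring)))) 2
    have hp8 : p % 8 = 1 := by
      obtain ⟨j, rfl⟩ : (2 : ℤ) ∣ m := by omega
      have : (4 * (5 * (2 * j)) * k) = 8 * (5 * j * k) := by ring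
      omega
    exact exists_eq_of_two_mul_prime hp hm (t := 1) (c := 20 * k + 1)
      (by linear_combination -hk) hp8 (by omega) (by omega)

theorem exists_eq_five_mul_of_eq_five_mul {x y z m : ℤ} (h : x ^ 2 + 2 * y ^ 2 + 5 * z ^ 2 = 5 * m) :
    ∃ x' y', x = 5 * x' ∧ y = 5 * y' ∧ z ^ 2 = m - 5 * (x' ^ 2 + 2 * y' ^ 2) := by
  obtain ⟨⟨x', rfl⟩, ⟨y', rfl⟩⟩ := five_dvd_of_dvd_mul_sq_add_sq (b := 2) (by norm_num) (x := x)
    (y := y) ⟨m - z ^ 2, by linear_combination h⟩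
  exact ⟨x', y', rfl, rfl, by linarith⟩

theorem ne_of_emod_twentyfive (k : ℕ) {n : ℤ} (hn : n % 25 = 10 ∨ n % 25 = 15) (x y z : ℤ) :
    x ^ 2 + 2 * y ^ 2 + 5 * z ^ 2 ≠ 25 ^ k * n := by
  induction k generalizing x y z with
  | zero =>
    intro h
    obtain ⟨j, rfl⟩ : (5 : ℤ) ∣ n := by omega
    obtain ⟨x', y', -, -, hz⟩ := exists_eq_five_mul_of_eq_five_mul (h.trans (by ring : _ = 5 * j))
    have := (five_dvd_of_dvd_mul_sq_add_sq (b := -j) (by omega) (x := z) (y := 1)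
      ⟨-(x' ^ 2 + 2 * y' ^ 2), by linear_combination hz⟩).2
    omega
  | succ k ih =>
    intro h
    obtain ⟨x', y', rfl, rfl, hz⟩ :=
      exists_eq_five_mul_of_eq_five_mul (h.trans (by ring : _ = 5 * (5 * (25 ^ k * n))))
    obtain ⟨z', rfl⟩ : (5 : ℤ) ∣ z := (by norm_num : Prime (5 : ℤ)).dvd_of_dvd_pow (n := 2)
      ⟨25 ^ k * n - (x' ^ 2 + 2 * y' ^ 2), by linear_combination hz⟩
    exact ih x' y' z' (by linarith [pow_succ (25 : ℤ) k])

theorem exists_eq_of_forall_ne {m : ℕ} (hm : 0 < m)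
    (h : ∀ (k : ℕ) (n : ℤ), n % 25 = 10 ∨ n % 25 = 15 → (m : ℤ) ≠ 25 ^ k * n) :
    ∃ x y z : ℤ, x ^ 2 + 2 * y ^ 2 + 5 * z ^ 2 = m := by
  induction m using Nat.strong_induction_on with
  | _ m ih =>
    by_cases h4 : 4 ∣ m
    · obtain ⟨m, rfl⟩ := h4
      obtain ⟨x, y, z, hxyz⟩ := ih m (by omega) (by omega) fun k n hn hmn =>
        h k (4 * n) (by omega) (by push_cast; rw [hmn]; ring)
      exact ⟨2 * x, 2 * y, 2 * z, by push_cast; linear_combination 4 * hxyz⟩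
    by_cases h25 : 25 ∣ m
    · obtain ⟨m, rfl⟩ := h25
      obtain ⟨x, y, z, hxyz⟩ := ih m (by omega) (by omega) fun k n hn hmn =>
        h (k + 1) n hn (by push_cast; rw [hmn]; ring)
      exact ⟨5 * x, 5 * y, 5 * z, by push_cast; linear_combination 25 * hxyz⟩
    have h0 : ¬ ((m : ℤ) % 25 = 10 ∨ (m : ℤ) % 25 = 15) := fun hn => h 0 m hn (by ring)
    have hm' : (0 : ℤ) < m := by exact_mod_cast hm
    rcases (by omega : m % 2 = 1 ∨ m % 8 = 2 ∨ m % 8 = 6) with h2 | h2 | h2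
    · exact exists_eq_of_odd hm' (by omega) (by omega)
    · exact exists_eq_of_mod_eight_eq_two hm' (by omega) (by omega)
    · exact exists_eq_of_mod_eight_eq_six hm' (by omega) (by omega)

theorem rep_x2_2y2_5z2 (m : ℤ) (hm : 0 < m) :
    (∃ x y z : ℤ, x ^ 2 + 2 * y ^ 2 + 5 * z ^ 2 = m) ↔
      ((¬ ∃ k l : ℕ, m = 25 ^ k * (25 * l + 10)) ∧
        ¬ ∃ k l : ℕ, m = 25 ^ k * (25 * l - 10)) := by
  constructor
  · rintro ⟨x, y, z, h⟩
    constructor <;> rintro ⟨k, l, rfl⟩ <;> exact ne_of_emod_twentyfive k (by omega) x y z h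
  · rintro ⟨h₁, h₂⟩
    lift m to ℕ using hm.le
    refine exists_eq_of_forall_ne (by exact_mod_cast hm) fun k n hn hmn => ?_
    have hn0 : 0 < n := pos_of_mul_pos_right (hmn ▸ hm) (by positivity)
    rcases hn with hn | hn
    · exact h₁ ⟨k, (n / 25).toNat, by rw [hmn]; congr 1; omega⟩
    · exact h₂ ⟨k, (n / 25 + 1).toNat, by rw [hmn]; congr 1; omega⟩
end
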